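/- arXiv:1107.1424 — 10 statements merged into one kernel-verified Lean document; each statement's English description precedes it below -/
import Mathlib

section
/- The function f is differentiable on (0,∞) and satisfies, for every r > 0, the first-order differential equation −f'(r)·r³ + (1 − f(r))·r² = (ξ/2)·(2 f'(r) r (1 − f(r)) + (1 − f(r))²). (This is the quantum-corrected Einstein equation for a static spherically symmetric metric with e^{−λ} = e^{ν} = f, i.e. e^{−λ}(λ'/r − 1/r²) + 1/r² = (ξ/2)(e^{−2λ}(2λ'/r³ + 1/r⁴) − 2e^{−λ}(λ'/r³ + 1/r⁴) + 1/r⁴), written in terms of f.) -/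
/-- The quantum-corrected metric function `f` is differentiable on `(0,∞)` and
satisfies the first-order quantum-corrected Einstein equation
`-f'(r) r^3 + (1 - f r) r^2 = (ξ/2) (2 f'(r) r (1 - f r) + (1 - f r)^2)`. -/
theorem metric_function_satisfies_einstein_equation
    (ξ K : ℝ) (hξ : 0 < ξ) (hK : 0 < K)
    (f : ℝ → ℝ)
    (hf : ∀ r, f r = 1 + r ^ 2 / ξ - Real.sqrt (r ^ 4 / ξ ^ 2 + 2 * K * r / ξ)) :
    ∀ r > 0, DifferentiableAt ℝ f r ∧
      -(deriv f r) * r ^ 3 + (1 - f r) * r ^ 2 =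
        ξ / 2 * (2 * deriv f r * r * (1 - f r) + (1 - f r) ^ 2) := by
  intro r hr
  have hpos : 0 < r ^ 4 / ξ ^ 2 + 2 * K * r / ξ := by positivity
  have hrad : HasDerivAt (fun x : ℝ => x ^ 4 / ξ ^ 2 + 2 * K * x / ξ)
      (4 * r ^ 3 / ξ ^ 2 + 2 * K / ξ) r := by
    simpa using ((hasDerivAt_pow 4 r).div_const (ξ ^ 2)).fun_add
      (((hasDerivAt_id r).const_mul (2 * K)).div_const ξ)
  have hquad : HasDerivAt (fun x : ℝ => 1 + x ^ 2 / ξ) (2 * r / ξ) r := by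
    simpa using ((hasDerivAt_pow 2 r).div_const ξ).const_add 1
  have hder := hquad.sub (hrad.sqrt hpos.ne')
  have hfun : f = (fun x : ℝ => 1 + x ^ 2 / ξ) -
      fun x => Real.sqrt (x ^ 4 / ξ ^ 2 + 2 * K * x / ξ) := funext hf
  rw [← hfun] at hder
  refine ⟨hder.differentiableAt, ?_⟩
  rw [hder.deriv, hf r]
  have hSpos := Real.sqrt_pos.mpr hpos
  have hSsq := Real.sq_sqrt hpos.le
  set S := Real.sqrt (r ^ 4 / ξ ^ 2 + 2 * K * r / ξ)
  have hK_eq : K = (S ^ 2 - r ^ 4 / ξ ^ 2) * ξ / (2 * r) := by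
    rw [hSsq]
    field_simp
    ring
  rw [hK_eq]
  field_simp
  ring
end

section
/- Let ν, λ : (0,∞) → ℝ be differentiable functions satisfying, for every r > 0, both quantum-corrected Einstein equations: (A) e^{−λ}(λ'/r − 1/r²) + 1/r² = (ξ/2)(e^{−2λ}(2λ'/r³ + 1/r⁴) + 2e^{−λ}(−λ'/r³ − 1/r⁴) + 1/r⁴) and (B) e^{−λ}(−ν'/r − 1/r²) + 1/r² = (ξ/2)(e^{−2λ}(−2ν'/r³ + 1/r⁴) + 2e^{−λ}(ν'/r³ − 1/r⁴) + 1/r⁴). If moreover ξ(e^{−λ(r)} − 1) ≠ r² for every r > 0, then ν'(r) + λ'(r) = 0 for every r > 0. -/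
/-- If differentiable `ν, lam : (0,∞) → ℝ` satisfy both quantum-corrected Einstein
equations (A) and (B), and `ξ (e^{-lam r} - 1) ≠ r^2` for all `r > 0`, then
`ν' + lam' = 0` on `(0,∞)`. -/
theorem nu_prime_add_lambda_prime_eq_zero
    (ξ : ℝ) (hξ : ξ ≠ 0)
    (ν lam : ℝ → ℝ)
    (hν : ∀ r > (0:ℝ), DifferentiableAt ℝ ν r)
    (hlam : ∀ r > (0:ℝ), DifferentiableAt ℝ lam r)
    (hA : ∀ r > (0:ℝ),
      Real.exp (-lam r) * (deriv lam r / r - 1 / r ^ 2) + 1 / r ^ 2 =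
        ξ / 2 * (Real.exp (-(2 * lam r)) * (2 * deriv lam r / r ^ 3 + 1 / r ^ 4)
          + 2 * Real.exp (-lam r) * (-(deriv lam r) / r ^ 3 - 1 / r ^ 4) + 1 / r ^ 4))
    (hB : ∀ r > (0:ℝ),
      Real.exp (-lam r) * (-(deriv ν r) / r - 1 / r ^ 2) + 1 / r ^ 2 =
        ξ / 2 * (Real.exp (-(2 * lam r)) * (-(2 * deriv ν r) / r ^ 3 + 1 / r ^ 4)
          + 2 * Real.exp (-lam r) * (deriv ν r / r ^ 3 - 1 / r ^ 4) + 1 / r ^ 4))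
    (hne : ∀ r > (0:ℝ), ξ * (Real.exp (-lam r) - 1) ≠ r ^ 2) :
    ∀ r > (0:ℝ), deriv ν r + deriv lam r = 0 := by
  intro r hr
  have hr0 : r ≠ 0 := hr.ne'
  have hexp : Real.exp (-(2 * lam r)) = Real.exp (-lam r) ^ 2 := by
    rw [← Real.exp_nat_mul]
    congr 1
    push_cast
    ring
  have a := hA r hr
  have b := hB r hr
  rw [hexp] at a b
  have hfac : Real.exp (-lam r) * (r ^ 2 - ξ * (Real.exp (-lam r) - 1)) *
      (deriv ν r + deriv lam r) = 0 := by
    field_simp at a b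
    refine mul_left_cancel₀ (mul_ne_zero two_ne_zero hr0) ?_
    linear_combination a - b
  exact (mul_eq_zero.mp hfac).resolve_left
    (mul_ne_zero (Real.exp_ne_zero _) (sub_ne_zero.mpr (hne r hr).symm))
end

section
/- Let λ : (0,∞) → ℝ be a differentiable function satisfying, for every r > 0, the equation e^{−λ}(λ'/r − 1/r²) + 1/r² = (ξ/2)(e^{−2λ}(2λ'/r³ + 1/r⁴) − 2e^{−λ}(λ'/r³ + 1/r⁴) + 1/r⁴). Then the function r ↦ −r e^{−λ(r)} + r + (ξ/2)(e^{−2λ(r)}/r − 2e^{−λ(r)}/r + 1/r) is constant on (0,∞); i.e. there is a constant K with e^{−2λ} − 2(1 + r²/ξ)e^{−λ} + 1 + 2r²/ξ − 2Kr/ξ = 0 for all r > 0. -/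
/-- If a differentiable `lam : (0,∞) → ℝ` satisfies the quantum-corrected Einstein
equation, then `r ↦ -r e^{-lam r} + r + (ξ/2)(e^{-2 lam r}/r - 2 e^{-lam r}/r + 1/r)`
is constant on `(0,∞)`; i.e. there is a constant `K` with
`e^{-2 lam} - 2(1 + r^2/ξ) e^{-lam} + 1 + 2 r^2/ξ - 2 K r/ξ = 0` for all `r > 0`. -/
theorem einstein_equation_first_integral
    (ξ : ℝ) (hξ : ξ ≠ 0)
    (lam : ℝ → ℝ)
    (hlam : ∀ r > (0:ℝ), DifferentiableAt ℝ lam r)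
    (heq : ∀ r > (0:ℝ),
      Real.exp (-lam r) * (deriv lam r / r - 1 / r ^ 2) + 1 / r ^ 2 =
        ξ / 2 * (Real.exp (-(2 * lam r)) * (2 * deriv lam r / r ^ 3 + 1 / r ^ 4)
          - 2 * Real.exp (-lam r) * (deriv lam r / r ^ 3 + 1 / r ^ 4) + 1 / r ^ 4)) :
    ∃ K : ℝ,
      (∀ r > (0:ℝ),
        -r * Real.exp (-lam r) + r +
          ξ / 2 * (Real.exp (-(2 * lam r)) / r - 2 * Real.exp (-lam r) / r + 1 / r) = K) ∧
      (∀ r > (0:ℝ),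
        Real.exp (-(2 * lam r)) - 2 * (1 + r ^ 2 / ξ) * Real.exp (-lam r)
          + 1 + 2 * r ^ 2 / ξ - 2 * K * r / ξ = 0) := by
  set F : ℝ → ℝ := fun r => -r * Real.exp (-lam r) + r +
    ξ / 2 * (Real.exp (-(2 * lam r)) / r - 2 * Real.exp (-lam r) / r + 1 / r) with hF
  have hderiv : ∀ r > (0:ℝ), HasDerivAt F 0 r := by
    intro r hr
    have hr0 : r ≠ 0 := hr.ne'
    have hl := (hlam r hr).hasDerivAt
    have h1 : HasDerivAt (fun x => Real.exp (-lam x)) _ r := hl.neg.exp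
    have h2 : HasDerivAt (fun x => Real.exp (-(2 * lam x))) _ r := (hl.const_mul 2).neg.exp
    have hid := hasDerivAt_id' r
    have h := ((hid.neg.mul h1).add hid).add
      ((((h2.div hid hr0).sub ((h1.const_mul 2).div hid hr0)).add
        ((hasDerivAt_const r (1:ℝ)).div hid hr0)).const_mul (ξ / 2))
    refine h.congr_deriv ?_
    have e := heq r hr
    simp only [Pi.neg_apply]
    generalize Real.exp (-lam r) = a at e ⊢
    generalize Real.exp (-(2 * lam r)) = b at e ⊢
    generalize deriv lam r = d at e ⊢
    field_simp at e ⊢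
    linear_combination e
  have hconst : ∀ r > (0:ℝ), F r = F 1 := fun r hr =>
    isOpen_Ioi.is_const_of_deriv_eq_zero isPreconnected_Ioi
      (fun x hx => (hderiv x hx).differentiableAt.differentiableWithinAt)
      (fun x hx => (hderiv x hx).deriv) (Set.mem_Ioi.2 hr) (Set.mem_Ioi.2 one_pos)
  refine ⟨F 1, hconst, fun r hr => ?_⟩
  have hr0 : r ≠ 0 := hr.ne'
  rw [← hconst r hr, hF]
  field_simp
  ring
end

section
/- The limit of r·(1 − f(r)) as r → ∞ equals K; hence the integration constant is identified with the Schwarzschild mass parameter, K = 2GM. -/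
open Filter

/-- Rationalized form of `r * (√(r ^ 4 / ξ ^ 2 + 2 * K * r / ξ) - r ^ 2 / ξ)`. -/
lemma mul_sqrt_sub_eq_div {ξ K r : ℝ} (hξ : 0 < ξ) (hK : 0 < K) (hr : 0 < r) :
    r * (√(r ^ 4 / ξ ^ 2 + 2 * K * r / ξ) - r ^ 2 / ξ) =
      2 * K / (√(1 + 2 * K * ξ / r ^ 3) + 1) := by
  have hsqrt : √(r ^ 4 / ξ ^ 2 + 2 * K * r / ξ) =
      r ^ 2 / ξ * √(1 + 2 * K * ξ / r ^ 3) := by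
    rw [show r ^ 4 / ξ ^ 2 + 2 * K * r / ξ =
        (r ^ 2 / ξ) ^ 2 * (1 + 2 * K * ξ / r ^ 3) by field_simp,
      Real.sqrt_mul (sq_nonneg _), Real.sqrt_sq (by positivity)]
  have hsq : √(1 + 2 * K * ξ / r ^ 3) ^ 2 = 1 + 2 * K * ξ / r ^ 3 :=
    Real.sq_sqrt (by positivity)
  rw [hsqrt, eq_div_iff (by positivity)]
  calc
    _ = r ^ 3 / ξ * (√(1 + 2 * K * ξ / r ^ 3) ^ 2 - 1) := by ring
    _ = 2 * K := by
      rw [hsq]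
      field_simp
      ring

/-- `r (1 - f r) → K` as `r → ∞`: the integration constant is identified with the
Schwarzschild mass parameter `K = 2GM`. -/
theorem limit_identifies_mass
    (ξ K : ℝ) (hξ : 0 < ξ) (hK : 0 < K)
    (f : ℝ → ℝ)
    (hf : ∀ r, f r = 1 + r ^ 2 / ξ - Real.sqrt (r ^ 4 / ξ ^ 2 + 2 * K * r / ξ)) :
    Tendsto (fun r => r * (1 - f r)) atTop (nhds K) := by
  have hzero : Tendsto (fun r : ℝ => 2 * K * ξ / r ^ 3) atTop (nhds 0) :=
    tendsto_const_nhds.div_atTop (tendsto_pow_atTop (by norm_num))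
  have hlim : Tendsto (fun r : ℝ => 2 * K / (√(1 + 2 * K * ξ / r ^ 3) + 1)) atTop
      (nhds (2 * K / (√(1 + 0) + 1))) :=
    tendsto_const_nhds.div ((hzero.const_add 1).sqrt.add_const 1) (by positivity)
  rw [show 2 * K / (√(1 + 0) + 1) = K by rw [add_zero, Real.sqrt_one]; ring] at hlim
  refine hlim.congr' ?_
  filter_upwards [eventually_gt_atTop 0] with r hr
  rw [← mul_sqrt_sub_eq_div hξ hK hr, hf]
  ring
end

section
/- The limit of r⁴·(f(r) − 1 + K/r) as r → ∞ equals K²ξ/2; i.e. f(r) has the large-distance expansion f(r) = 1 − K/r + K²ξ/(2r⁴) + o(1/r⁴). -/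
open Filter

/-- `r^4 (f r - 1 + K/r) → K^2 ξ/2` as `r → ∞`: the large-distance expansion
`f r = 1 - K/r + K^2 ξ/(2 r^4) + o(1/r^4)`. -/
theorem large_distance_expansion
    (ξ K : ℝ) (hξ : 0 < ξ) (hK : 0 < K)
    (f : ℝ → ℝ)
    (hf : ∀ r, f r = 1 + r ^ 2 / ξ - Real.sqrt (r ^ 4 / ξ ^ 2 + 2 * K * r / ξ)) :
    Tendsto (fun r => r ^ 4 * (f r - 1 + K / r)) atTop (nhds (K ^ 2 * ξ / 2)) := by
  have hx : Tendsto (fun r : ℝ => K * ξ / r ^ 3) atTop (nhds 0) :=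
    tendsto_const_nhds.div_atTop (tendsto_pow_atTop three_ne_zero)
  have hlim : Tendsto (fun x : ℝ => K ^ 2 * ξ / (1 + x + Real.sqrt (1 + 2 * x)))
      (nhds 0) (nhds (K ^ 2 * ξ / 2)) := by
    have hc : ContinuousAt (fun x : ℝ => K ^ 2 * ξ / (1 + x + Real.sqrt (1 + 2 * x))) 0 := by
      refine ContinuousAt.div (by fun_prop) (by fun_prop) ?_
      norm_num
    have h0 : K ^ 2 * ξ / (1 + 0 + Real.sqrt (1 + 2 * 0)) = K ^ 2 * ξ / 2 := by norm_num
    simpa only [ContinuousAt, h0] using hc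
  refine (hlim.comp hx).congr' ?_
  filter_upwards [eventually_gt_atTop 0] with r hr
  have hsqrt : Real.sqrt (r ^ 4 / ξ ^ 2 + 2 * K * r / ξ)
      = r ^ 2 / ξ * Real.sqrt (1 + 2 * (K * ξ / r ^ 3)) := by
    rw [← Real.sqrt_sq (show 0 ≤ r ^ 2 / ξ by positivity), ← Real.sqrt_mul (by positivity)]
    congr 1
    field_simp
  have hsq := Real.sq_sqrt (show 0 ≤ 1 + 2 * (K * ξ / r ^ 3) by positivity)
  have hs := Real.sqrt_nonneg (1 + 2 * (K * ξ / r ^ 3))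
  rw [hf, hsqrt, Function.comp_apply]
  set x := K * ξ / r ^ 3 with hxdef
  set s := Real.sqrt (1 + 2 * x)
  have hxpos : 0 < x := by positivity
  have hKx : K = x * r ^ 3 / ξ := by rw [hxdef]; field_simp
  clear_value x s
  subst hKx
  rw [div_eq_iff (by positivity)]
  field_simp
  linear_combination r ^ 2 * hsq
end

section
/- The limit of (f(r) − 1 + √(2Kr/ξ))/r² as r → 0⁺ equals 1/ξ; in particular, f(r) → 1 − √(2Kr/ξ) as r → 0⁺, exhibiting the short-distance behavior of the quantum-corrected metric. -/
open Filter

/-- Perturbing `c * r` by `r ^ 4 / ξ ^ 2` under the square root costs at most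
`r ^ 3 * √(c * r) / (ξ ^ 2 * c)`. -/
theorem sqrt_pow_four_add_le {ξ c r : ℝ} (hξ : 0 < ξ) (hc : 0 < c) (hr : 0 < r) :
    √(r ^ 4 / ξ ^ 2 + c * r) ≤ √(c * r) + r ^ 2 * (r * √(c * r) / (ξ ^ 2 * c)) := by
  refine Real.sqrt_le_iff.mpr ⟨by positivity, ?_⟩
  have hs : √(c * r) ^ 2 = c * r := Real.sq_sqrt (by positivity)
  have hcross : √(c * r) * (r ^ 2 * (r * √(c * r) / (ξ ^ 2 * c))) = r ^ 4 / ξ ^ 2 := by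
    calc _ = r ^ 3 * √(c * r) ^ 2 / (ξ ^ 2 * c) := by ring
      _ = r ^ 4 / ξ ^ 2 := by rw [hs]; field_simp
  have hpos : 0 ≤ r ^ 4 / ξ ^ 2 := by positivity
  nlinarith [sq_nonneg (r ^ 2 * (r * √(c * r) / (ξ ^ 2 * c)))]

/-- `(f r - 1 + √(2 K r/ξ))/r^2 → 1/ξ` as `r → 0⁺`; in particular
`f r - (1 - √(2 K r/ξ)) → 0` as `r → 0⁺`, exhibiting the short-distance behavior
of the quantum-corrected metric. -/
theorem short_distance_behavior
    (ξ K : ℝ) (hξ : 0 < ξ) (hK : 0 < K)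
    (f : ℝ → ℝ)
    (hf : ∀ r, f r = 1 + r ^ 2 / ξ - Real.sqrt (r ^ 4 / ξ ^ 2 + 2 * K * r / ξ)) :
    Tendsto (fun r => (f r - 1 + Real.sqrt (2 * K * r / ξ)) / r ^ 2)
        (nhdsWithin 0 (Set.Ioi 0)) (nhds (1 / ξ)) ∧
      Tendsto (fun r => f r - (1 - Real.sqrt (2 * K * r / ξ)))
        (nhdsWithin 0 (Set.Ioi 0)) (nhds 0) := by
  have hc : 0 < 2 * K / ξ := by positivity
  have hlin (r : ℝ) : 2 * K * r / ξ = 2 * K / ξ * r := by ring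
  simp only [hf, hlin]
  constructor
  · have hlower : Tendsto (fun r : ℝ => 1 / ξ - r * √(2 * K / ξ * r) / (ξ ^ 2 * (2 * K / ξ)))
        (nhdsWithin 0 (Set.Ioi 0)) (nhds (1 / ξ)) := by
      have hcont : Continuous
          fun r : ℝ => 1 / ξ - r * √(2 * K / ξ * r) / (ξ ^ 2 * (2 * K / ξ)) := by fun_prop
      simpa using (hcont.tendsto 0).mono_left nhdsWithin_le_nhds
    refine tendsto_of_tendsto_of_tendsto_of_le_of_le' hlower tendsto_const_nhds ?_ ?_
    all_goals
      filter_upwards [self_mem_nhdsWithin] with r (hr : 0 < r)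
      have hsq : r ^ 2 / ξ = 1 / ξ * r ^ 2 := by ring
    · rw [le_div_iff₀ (by positivity)]
      linarith [sqrt_pow_four_add_le hξ hc hr]
    · rw [div_le_iff₀ (by positivity)]
      have hmono : √(2 * K / ξ * r) ≤ √(r ^ 4 / ξ ^ 2 + 2 * K / ξ * r) :=
        Real.sqrt_le_sqrt (le_add_of_nonneg_left (by positivity))
      linarith
  · have hcont : Continuous fun r : ℝ => 1 + r ^ 2 / ξ - √(r ^ 4 / ξ ^ 2 + 2 * K / ξ * r) -
        (1 - √(2 * K / ξ * r)) := by fun_prop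
    simpa using (hcont.tendsto 0).mono_left nhdsWithin_le_nhds
end

section
/- The function f is differentiable on (0,∞) and f'(r) → −∞ as r → 0⁺; in particular f is strictly decreasing on some interval (0, δ), so the quantum-corrected gravitational potential is repulsive at short distances. -/
open Filter

/-- A function that is differentiable on a right neighbourhood of `a` and whose derivative tends
to `-∞` at `a` from the right is strictly decreasing just to the right of `a`. -/
theorem exists_strictAntiOn_Ioo_of_tendsto_deriv_atBot {f : ℝ → ℝ} {a : ℝ}
    (hd : ∀ x > a, DifferentiableAt ℝ f x)
    (hf : Tendsto (deriv f) (nhdsWithin a (Set.Ioi a)) atBot) :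
    ∃ b > a, StrictAntiOn f (Set.Ioo a b) := by
  obtain ⟨b, hb, hneg⟩ := mem_nhdsGT_iff_exists_Ioo_subset.1 (hf.eventually_lt_atBot 0)
  refine ⟨b, hb, strictAntiOn_of_deriv_neg (convex_Ioo a b)
    (fun x hx => (hd x hx.1).continuousAt.continuousWithinAt) fun x hx => ?_⟩
  rw [interior_Ioo] at hx
  exact hneg hx

/-- The derivative of the quantum-corrected metric function. -/
theorem hasDerivAt_correctedMetric {ξ K r : ℝ} (hξ : 0 < ξ) (hK : 0 < K) (hr : 0 < r) :
    HasDerivAt (fun r : ℝ => 1 + r ^ 2 / ξ - Real.sqrt (r ^ 4 / ξ ^ 2 + 2 * K * r / ξ))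
      (2 * r / ξ - (4 * r ^ 3 / ξ ^ 2 + 2 * K / ξ) *
        (2 * Real.sqrt (r ^ 4 / ξ ^ 2 + 2 * K * r / ξ))⁻¹) r := by
  have hrad : HasDerivAt (fun r : ℝ => r ^ 4 / ξ ^ 2 + 2 * K * r / ξ)
      (4 * r ^ 3 / ξ ^ 2 + 2 * K / ξ) r := by
    simpa using ((hasDerivAt_pow 4 r).div_const (ξ ^ 2)).fun_add
      (((hasDerivAt_id r).const_mul (2 * K)).div_const ξ)
  have hsq : HasDerivAt (fun r : ℝ => 1 + r ^ 2 / ξ) (2 * r / ξ) r := by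
    simpa using ((hasDerivAt_pow 2 r).div_const ξ).const_add 1
  simpa only [div_eq_mul_inv] using hsq.fun_sub (hrad.sqrt (by positivity))

/-- `f` is differentiable on `(0,∞)` and `f'(r) → -∞` as `r → 0⁺`; in particular
`f` is strictly decreasing on some interval `(0, δ)`: the quantum-corrected
gravitational potential is repulsive at short distances. -/
theorem repulsive_at_short_distance
    (ξ K : ℝ) (hξ : 0 < ξ) (hK : 0 < K)
    (f : ℝ → ℝ)
    (hf : ∀ r, f r = 1 + r ^ 2 / ξ - Real.sqrt (r ^ 4 / ξ ^ 2 + 2 * K * r / ξ)) :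
    (∀ r > (0:ℝ), DifferentiableAt ℝ f r) ∧
      Tendsto (deriv f) (nhdsWithin 0 (Set.Ioi 0)) atBot ∧
      ∃ δ > (0:ℝ), StrictAntiOn f (Set.Ioo 0 δ) := by
  obtain rfl : f = fun r => 1 + r ^ 2 / ξ - Real.sqrt (r ^ 4 / ξ ^ 2 + 2 * K * r / ξ) :=
    funext hf
  have hdiff := fun r (hr : r > (0:ℝ)) => (hasDerivAt_correctedMetric hξ hK hr).differentiableAt
  have hlim : Tendsto
      (deriv fun r : ℝ => 1 + r ^ 2 / ξ - Real.sqrt (r ^ 4 / ξ ^ 2 + 2 * K * r / ξ))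
      (nhdsWithin 0 (Set.Ioi 0)) atBot := by
    have hlin : Tendsto (fun r : ℝ => 2 * r / ξ) (nhdsWithin 0 (Set.Ioi 0)) (nhds 0) :=
      ((by fun_prop : Continuous fun r : ℝ => 2 * r / ξ).tendsto' 0 0 (by simp)).mono_left
        nhdsWithin_le_nhds
    have hnum : Tendsto (fun r : ℝ => 4 * r ^ 3 / ξ ^ 2 + 2 * K / ξ)
        (nhdsWithin 0 (Set.Ioi 0)) (nhds (2 * K / ξ)) :=
      ((by fun_prop : Continuous fun r : ℝ => 4 * r ^ 3 / ξ ^ 2 + 2 * K / ξ).tendsto' 0 _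
        (by simp)).mono_left nhdsWithin_le_nhds
    have hden : Tendsto (fun r : ℝ => 2 * Real.sqrt (r ^ 4 / ξ ^ 2 + 2 * K * r / ξ))
        (nhdsWithin 0 (Set.Ioi 0)) (nhdsWithin 0 (Set.Ioi 0)) := by
      refine tendsto_nhdsWithin_iff.2 ⟨((by fun_prop : Continuous fun r : ℝ =>
        2 * Real.sqrt (r ^ 4 / ξ ^ 2 + 2 * K * r / ξ)).tendsto' 0 0 (by simp)).mono_left
          nhdsWithin_le_nhds, ?_⟩
      filter_upwards [self_mem_nhdsWithin] with r hr
      have hr : 0 < r := hr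
      exact Set.mem_Ioi.2 (by positivity)
    have hmain := hnum.pos_mul_atTop (by positivity) (tendsto_inv_nhdsGT_zero.comp hden)
    refine (hlin.add_atBot (tendsto_neg_atTop_atBot.comp hmain)).congr' ?_
    filter_upwards [self_mem_nhdsWithin] with r hr
    rw [(hasDerivAt_correctedMetric hξ hK hr).deriv, sub_eq_add_neg]
    rfl
  exact ⟨hdiff, hlim, exists_strictAntiOn_Ioo_of_tendsto_deriv_atBot hdiff hlim⟩
end

section
/- For r > 0, f(r) = 0 if and only if 2r² − 2Kr + ξ = 0. Consequently, if K² > 2ξ then f has exactly two positive zeros (horizons), namely r₋ = (K − √(K² − 2ξ))/2 and r₊ = (K + √(K² − 2ξ))/2, which satisfy r₋ + r₊ = K and r₋·r₊ = ξ/2. -/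
/-- For `r > 0`, `f r = 0` iff `2 r^2 - 2 K r + ξ = 0`. Consequently, if `K^2 > 2 ξ`
then `f` has exactly two positive zeros (horizons),
`r₋ = (K - √(K^2 - 2ξ))/2` and `r₊ = (K + √(K^2 - 2ξ))/2`, with
`r₋ + r₊ = K` and `r₋ r₊ = ξ/2`. -/
theorem horizons_of_metric_function
    (ξ K : ℝ) (hξ : 0 < ξ) (hK : 0 < K)
    (f : ℝ → ℝ)
    (hf : ∀ r, f r = 1 + r ^ 2 / ξ - Real.sqrt (r ^ 4 / ξ ^ 2 + 2 * K * r / ξ)) :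
    (∀ r > (0:ℝ), f r = 0 ↔ 2 * r ^ 2 - 2 * K * r + ξ = 0) ∧
      (K ^ 2 > 2 * ξ →
        (0 < (K - Real.sqrt (K ^ 2 - 2 * ξ)) / 2) ∧
        (K - Real.sqrt (K ^ 2 - 2 * ξ)) / 2 < (K + Real.sqrt (K ^ 2 - 2 * ξ)) / 2 ∧
        f ((K - Real.sqrt (K ^ 2 - 2 * ξ)) / 2) = 0 ∧
        f ((K + Real.sqrt (K ^ 2 - 2 * ξ)) / 2) = 0 ∧
        (∀ r > (0:ℝ), f r = 0 →
          r = (K - Real.sqrt (K ^ 2 - 2 * ξ)) / 2 ∨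
          r = (K + Real.sqrt (K ^ 2 - 2 * ξ)) / 2) ∧
        (K - Real.sqrt (K ^ 2 - 2 * ξ)) / 2 + (K + Real.sqrt (K ^ 2 - 2 * ξ)) / 2 = K ∧
        (K - Real.sqrt (K ^ 2 - 2 * ξ)) / 2 * ((K + Real.sqrt (K ^ 2 - 2 * ξ)) / 2)
          = ξ / 2) := by
  have key : ∀ r > (0 : ℝ), f r = 0 ↔ 2 * r ^ 2 - 2 * K * r + ξ = 0 := by
    intro r hr
    have hsq : (1 + r ^ 2 / ξ) ^ 2 - (r ^ 4 / ξ ^ 2 + 2 * K * r / ξ) =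
        (2 * r ^ 2 - 2 * K * r + ξ) / ξ := by
      field_simp
      ring
    rw [hf, sub_eq_zero, eq_comm, Real.sqrt_eq_iff_eq_sq (by positivity) (by positivity),
      eq_comm, ← sub_eq_zero, hsq, div_eq_zero_iff, or_iff_left hξ.ne']
  refine ⟨key, fun hKξ => ?_⟩
  have hs : 0 < √(K ^ 2 - 2 * ξ) := Real.sqrt_pos.mpr (by linarith)
  have hs2 : √(K ^ 2 - 2 * ξ) ^ 2 = K ^ 2 - 2 * ξ := Real.sq_sqrt (by linarith)
  have hsK : √(K ^ 2 - 2 * ξ) < K := (Real.sqrt_lt' hK).mpr (by linarith)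
  set s := √(K ^ 2 - 2 * ξ)
  refine ⟨by linarith, by linarith, (key _ (by linarith)).mpr (by linear_combination hs2 / 2),
    (key _ (by linarith)).mpr (by linear_combination hs2 / 2), fun r hr hfr => ?_, by ring,
    by linear_combination -hs2 / 4⟩
  have hprod : (r - (K - s) / 2) * (r - (K + s) / 2) = 0 := by
    linear_combination (key r hr).mp hfr / 2 - hs2 / 4
  simpa only [mul_eq_zero, sub_eq_zero] using hprod
end

section
/- Let ν, λ : (0,∞) → ℝ be twice differentiable and let n be any real number. Then for every r > 0, the derivative of the function r ↦ ν'(r)·e^{ν(r)/2}·(e^{−λ(r)/2} − e^{−3λ(r)/2})·r^{n−4} equals g₃(r)·e^{(ν(r)+λ(r))/2}·r^{n−2} + (n − 4)·ν'(r)·(e^{λ(r)} − 1)·e^{−2λ(r)}·e^{(ν(r)+λ(r))/2}·r^{n−5}. (Thus the g₃ term in the quadratic curvature Lagrangian is, up to a total derivative, proportional to (n − 4), so it drops out of the n → 4 variational problem except for the exhibited correction term.) -/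
/-- For twice-differentiable `ν, lam : (0,∞) → ℝ`, any real `n` and `r > 0`, the
derivative of `s ↦ ν'(s) e^{ν(s)/2} (e^{-lam(s)/2} - e^{-3 lam(s)/2}) s^{n-4}`
equals `g₃ e^{(ν+lam)/2} r^{n-2} + (n-4) ν' (e^{lam} - 1) e^{-2 lam} e^{(ν+lam)/2} r^{n-5}`,
where `g₃ = ((ν'' + ν'^2/2 - ν' lam'/2)(e^{lam} - 1) + ν' lam') e^{-2 lam}/r^2`:
the `g₃` term in the quadratic curvature Lagrangian is, up to a total derivative,
proportional to `n - 4`. -/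
theorem g3_total_derivative_identity
    (ν lam : ℝ → ℝ)
    (hν : ∀ r > (0:ℝ), DifferentiableAt ℝ ν r)
    (hν' : ∀ r > (0:ℝ), DifferentiableAt ℝ (deriv ν) r)
    (hlam : ∀ r > (0:ℝ), DifferentiableAt ℝ lam r)
    (hlam' : ∀ r > (0:ℝ), DifferentiableAt ℝ (deriv lam) r)
    (n : ℝ) :
    ∀ r > (0:ℝ),
      deriv (fun s => deriv ν s * Real.exp (ν s / 2)
          * (Real.exp (-lam s / 2) - Real.exp (-(3 * lam s) / 2))
          * Real.rpow s (n - 4)) r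
        = ((deriv (deriv ν) r + (deriv ν r) ^ 2 / 2 - deriv ν r * deriv lam r / 2)
              * (Real.exp (lam r) - 1) + deriv ν r * deriv lam r)
            * Real.exp (-(2 * lam r)) / r ^ 2
            * Real.exp ((ν r + lam r) / 2) * Real.rpow r (n - 2)
          + (n - 4) * deriv ν r * (Real.exp (lam r) - 1) * Real.exp (-(2 * lam r))
            * Real.exp ((ν r + lam r) / 2) * Real.rpow r (n - 5) := by
  intro r hr
  have hexpν : HasDerivAt (fun s => Real.exp (ν s / 2))
      (Real.exp (ν r / 2) * (deriv ν r / 2)) r :=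
    ((hν r hr).hasDerivAt.div_const 2).exp
  have hexp₁ : HasDerivAt (fun s => Real.exp (-lam s / 2))
      (Real.exp (-lam r / 2) * (-deriv lam r / 2)) r :=
    ((hlam r hr).hasDerivAt.fun_neg.div_const 2).exp
  have hexp₃ : HasDerivAt (fun s => Real.exp (-(3 * lam s) / 2))
      (Real.exp (-(3 * lam r) / 2) * (-(3 * deriv lam r) / 2)) r :=
    (((hlam r hr).hasDerivAt.const_mul 3).fun_neg.div_const 2).exp
  have hpow : HasDerivAt (fun s : ℝ => Real.rpow s (n - 4))
      ((n - 4) * Real.rpow r (n - 4 - 1)) r :=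
    Real.hasDerivAt_rpow_const (Or.inl hr.ne')
  have hprod := (((hν' r hr).hasDerivAt.fun_mul hexpν).fun_mul
    (hexp₁.fun_sub hexp₃)).fun_mul hpow
  rw [hprod.deriv]
  have hr₂ : Real.rpow r (n - 2) = Real.rpow r (n - 4) * r ^ 2 := by
    have h := Real.rpow_add hr (n - 4) 2
    rw [Real.rpow_two] at h
    rw [show n - 2 = n - 4 + 2 by ring]
    exact h
  have he₁ : Real.exp (-lam r / 2)
      = Real.exp (lam r) * Real.exp (-(2 * lam r)) * Real.exp (lam r / 2) := by
    rw [← Real.exp_add, ← Real.exp_add]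
    ring_nf
  have he₃ : Real.exp (-(3 * lam r) / 2)
      = Real.exp (-(2 * lam r)) * Real.exp (lam r / 2) := by
    rw [← Real.exp_add]
    ring_nf
  have heν : Real.exp ((ν r + lam r) / 2) = Real.exp (ν r / 2) * Real.exp (lam r / 2) := by
    rw [← Real.exp_add]
    ring_nf
  rw [hr₂, he₁, he₃, heν, show n - 4 - 1 = n - 5 by ring]
  have hr₀ : r ≠ 0 := hr.ne'
  generalize Real.rpow r (n - 4) = p
  generalize Real.rpow r (n - 5) = q
  generalize Real.exp (-(2 * lam r)) = x
  generalize Real.exp (lam r / 2) = y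
  generalize Real.exp (lam r) = z
  generalize Real.exp (ν r / 2) = w
  field_simp
  ring
end

section
/- Let ν, λ : (0,∞) → ℝ be twice differentiable, fix r > 0, and regard the Gauss–Bonnet combination F(n) = Riemₙ² − 4·Ricₙ² + Rₙ² as a function of the real variable n via the n-dimensional curvature formulas. Then F(4) = −4·g₃ and the derivative of F at n = 4 equals dF/dn|_{n=4} = −6·g₃ − 4·(ν' − λ')·((e^{λ} − 1)/r)·(e^{−λ}/r)² − 2·((e^{λ} − 1)·e^{−λ}/r²)². (These are the terms f₀ and f₁ in the expansion F = f₀ + (n − 4)f₁ + O((n − 4)²) used to compute the finite quantum correction H^{μν} for the static spherically symmetric metric with Gauss–Bonnet coefficients A = 1, B = −4, C = 1.) -/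
/-- Regard the Gauss–Bonnet combination `F n = Riemₙ² - 4 Ricₙ² + Rₙ²` of the
static spherically symmetric metric as a function of the real dimension `n`, via
the `n`-dimensional curvature formulas in `X`, `P`, `Q`, `S`. Then `F 4 = -4 g₃`
and `dF/dn` at `n = 4` equals
`-6 g₃ - 4 (ν' - lam') ((e^{lam} - 1)/r) (e^{-lam}/r)^2 - 2 ((e^{lam} - 1) e^{-lam}/r^2)^2`.
These are the coefficients `f₀` and `f₁` in `F = f₀ + (n-4) f₁ + O((n-4)^2)`. -/
theorem gauss_bonnet_expansion_in_dimension
    (ν lam : ℝ → ℝ)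
    (hν : ∀ r > (0:ℝ), DifferentiableAt ℝ ν r)
    (hν' : ∀ r > (0:ℝ), DifferentiableAt ℝ (deriv ν) r)
    (hlam : ∀ r > (0:ℝ), DifferentiableAt ℝ lam r)
    (hlam' : ∀ r > (0:ℝ), DifferentiableAt ℝ (deriv lam) r)
    (r : ℝ) (hr : 0 < r)
    (X P Q S g₃ : ℝ)
    (hX : X = (deriv (deriv ν) r + (deriv ν r) ^ 2 / 2
      - deriv ν r * deriv lam r / 2) * Real.exp (-lam r))
    (hP : P = Real.exp (-lam r) / r)
    (hQ : Q = (Real.exp (lam r) - 1) * Real.exp (-lam r) / r ^ 2)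
    (hS : S = deriv ν r - deriv lam r)
    (hg₃ : g₃ = X * Q + deriv ν r * deriv lam r * P ^ 2)
    (F : ℝ → ℝ)
    (hF : ∀ n : ℝ, F n =
      (X ^ 2 + (n - 2) * ((deriv ν r) ^ 2 + (deriv lam r) ^ 2) * P ^ 2
        + 2 * (n - 2) * (n - 3) * Q ^ 2)
      - 4 * (X ^ 2 / 2 + (n - 2) / 2 * X * S * P
        + (n - 2) ^ 2 / 4 * ((deriv ν r) ^ 2 + (deriv lam r) ^ 2) * P ^ 2
        + (n - 2) / 4 * S ^ 2 * P ^ 2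
        - (n - 2) * (n - 3) * S * P * Q
        + (n - 2) * (n - 3) ^ 2 * Q ^ 2)
      + (X + (n - 2) * S * P - (n - 2) * (n - 3) * Q) ^ 2) :
    F 4 = -4 * g₃ ∧
      deriv F 4 = -6 * g₃
        - 4 * (deriv ν r - deriv lam r) * ((Real.exp (lam r) - 1) / r)
          * (Real.exp (-lam r) / r) ^ 2
        - 2 * ((Real.exp (lam r) - 1) * Real.exp (-lam r) / r ^ 2) ^ 2 := by
  have hF' : F = fun n => (n - 2) * (n - 3) *
      (-2 * g₃ - 2 * (n - 4) * (S * P * Q) + (n - 4) * (n - 5) * Q ^ 2) := by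
    funext n
    rw [hF n, hg₃, hS]
    ring
  refine ⟨by rw [hF']; ring, ?_⟩
  have hsub : ∀ c : ℝ, HasDerivAt (fun n : ℝ => n - c) 1 4 :=
    fun c => (hasDerivAt_id (4 : ℝ)).sub_const c
  have hderiv := ((hsub 2).mul (hsub 3)).mul
    (((((hsub 4).const_mul 2).mul_const (S * P * Q)).const_sub (-2 * g₃)).add
      (((hsub 4).mul (hsub 5)).mul_const (Q ^ 2)))
  rw [hF']
  refine hderiv.deriv.trans ?_
  simp only [Pi.mul_apply, Pi.add_apply]
  rw [hS, hP, hQ]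
  ring
end
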